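/- Removing inactive rules preserves answer sets: for an answer-set program P, an interpretation I is an answer set of grd(P) if and only if I is an answer set of the program obtained from grd(P) by deleting all inactive rules. -/

import Mathlib

/-! Basic syntax: terms, atoms, rules -/

inductive Term (Va Co : Type) where
  | var (v : Va)
  | const (c : Co)
deriving DecidableEq

structure Atom (Pr Va Co : Type) where
  pred : Pr
  args : List (Term Va Co)
deriving DecidableEq

/-- A normal rule: head with at most one atom, positive and negative body. -/
structure Rule (Pr Va Co : Type) where
  head : Option (Atom Pr Va Co)
  pos : Finset (Atom Pr Va Co)
  neg : Finset (Atom Pr Va Co)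
deriving DecidableEq

variable {Pr Va Co : Type} [DecidableEq Pr] [DecidableEq Va] [DecidableEq Co]

def Term.vars : Term Va Co → Set Va
  | .var v => {v}
  | .const _ => ∅

def Atom.vars (a : Atom Pr Va Co) : Set Va := ⋃ t ∈ a.args, t.vars

/-- Variables of a set of atoms. -/
def atomsVars (S : Set (Atom Pr Va Co)) : Set Va := ⋃ a ∈ S, a.vars

def Rule.vars (r : Rule Pr Va Co) : Set Va :=
  (r.head.elim ∅ Atom.vars) ∪ atomsVars (r.pos : Set (Atom Pr Va Co)) ∪
    atomsVars (r.neg : Set (Atom Pr Va Co))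

def Rule.IsGround (r : Rule Pr Va Co) : Prop := r.vars = ∅

/-- Safety: every variable of the rule occurs in its positive body. -/
def Rule.Safe (r : Rule Pr Va Co) : Prop := r.vars ⊆ atomsVars (r.pos : Set (Atom Pr Va Co))

/-! Substitutions and grounding -/

abbrev Subst (Va Co : Type) := Va → Term Va Co

def Term.subst (σ : Subst Va Co) : Term Va Co → Term Va Co
  | .var v => σ v
  | .const c => .const c

def Atom.subst (σ : Subst Va Co) (a : Atom Pr Va Co) : Atom Pr Va Co :=
  ⟨a.pred, a.args.map (Term.subst σ)⟩

def Rule.subst (σ : Subst Va Co) (r : Rule Pr Va Co) : Rule Pr Va Co :=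
  ⟨r.head.map (Atom.subst σ), r.pos.image (Atom.subst σ), r.neg.image (Atom.subst σ)⟩

/-- `σ` is a (grounding) substitution for all variables in `S`. -/
def GroundsAll (σ : Subst Va Co) (S : Set Va) : Prop :=
  ∀ v ∈ S, ∃ c, σ v = Term.const c

/-- Ground instances of a rule. -/
def grd (r : Rule Pr Va Co) : Set (Rule Pr Va Co) :=
  { r' | ∃ σ : Subst Va Co, GroundsAll σ r.vars ∧ r' = r.subst σ }

/-- Ground instances of a program. -/
def grdP (P : Finset (Rule Pr Va Co)) : Set (Rule Pr Va Co) :=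
  ⋃ r ∈ P, grd r

/-! Assignments -/

structure Assignment (Pr Va Co : Type) where
  pos : Set (Atom Pr Va Co)
  neg : Set (Atom Pr Va Co)

/-- Combination `A ⊎ A'` of two assignments. -/
def Assignment.combine (A B : Assignment Pr Va Co) : Assignment Pr Va Co :=
  ⟨A.pos ∪ B.pos, A.neg ∪ B.neg⟩

/-- A grounder memory identified with a fully positive assignment. -/
def memAssign (G : Set (Atom Pr Va Co)) : Assignment Pr Va Co := ⟨G, ∅⟩

/-- A ground rule is of interest w.r.t. `A` if its positive body is contained in `A⁺`. -/
def OfInterest (r : Rule Pr Va Co) (A : Assignment Pr Va Co) : Prop :=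
  ↑r.pos ⊆ A.pos

/-- `a` occurs as a fact (rule with empty body) of `P`. -/
def IsFactOf (P : Finset (Rule Pr Va Co)) (a : Atom Pr Va Co) : Prop :=
  ∃ f ∈ P, f.pos = ∅ ∧ f.neg = ∅ ∧ f.head = some a

/-- A ground rule is inactive (w.r.t. program `P`). -/
def Inactive (P : Finset (Rule Pr Va Co)) (r : Rule Pr Va Co) : Prop :=
  (∃ a ∈ r.pos, ∀ p ∈ P, ∀ h, p.head = some h → h.pred ≠ a.pred) ∨
  (∃ a ∈ r.neg, IsFactOf P a)

/-- Weak applicability of a ground rule w.r.t. an assignment. -/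
def WeaklyApplicable (P : Finset (Rule Pr Va Co)) (r : Rule Pr Va Co)
    (A : Assignment Pr Va Co) : Prop :=
  ↑r.pos ∩ A.neg = (∅ : Set (Atom Pr Va Co)) ∧ ¬ Inactive P r

/-- The assigned literals `L_A` of the ground instance `rσ` w.r.t. `A`. -/
def assignedLits (r : Rule Pr Va Co) (σ : Subst Va Co) (A : Assignment Pr Va Co) :
    Set (Atom Pr Va Co) :=
  { l | l ∈ r.pos ∧ l.subst σ ∈ A.pos }

/-- `rσ` is all-variable-assigning w.r.t. `A`. -/
def AllVarAssigning (r : Rule Pr Va Co) (σ : Subst Va Co) (A : Assignment Pr Va Co) : Prop :=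
  atomsVars (assignedLits r σ A) = r.vars

/-- The ground instance `rσ` is `k`-unassigned w.r.t. `A`. -/
def KUnassigned (P : Finset (Rule Pr Va Co)) (r : Rule Pr Va Co) (σ : Subst Va Co)
    (A : Assignment Pr Va Co) (k : ℕ) : Prop :=
  WeaklyApplicable P (r.subst σ) A ∧
  AllVarAssigning r σ A ∧
  (↑r.pos \ assignedLits r σ A).ncard ≤ k

/-! Lazy-grounding strategies -/

/-- The default grounding strategy `s_def`. -/
def defaultStrategy (P : Finset (Rule Pr Va Co)) (A : Assignment Pr Va Co)
    (G : Set (Atom Pr Va Co)) (r : Rule Pr Va Co) :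
    Set (Atom Pr Va Co) × Set (Rule Pr Va Co) :=
  (A.pos, { r' ∈ grd r | ¬ Inactive P r' ∧ OfInterest r' A })

/-- Ground rules produced by the `k`-unassigned condition w.r.t. an assignment. -/
def kUnassignedSet (P : Finset (Rule Pr Va Co)) (kco kru : ℕ) (r : Rule Pr Va Co)
    (A : Assignment Pr Va Co) : Set (Rule Pr Va Co) :=
  { r' | ∃ σ : Subst Va Co, GroundsAll σ r.vars ∧ r' = r.subst σ ∧
      r'.head = none ∧ KUnassigned P r σ A kco } ∪
  { r' | ∃ σ : Subst Va Co, GroundsAll σ r.vars ∧ r' = r.subst σ ∧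
      r'.head ≠ none ∧ KUnassigned P r σ A kru }

/-- The `k`-unassigned grounding strategy `s_{k_co,k_ru}`. -/
def kUnassignedStrategy (P : Finset (Rule Pr Va Co)) (kco kru : ℕ)
    (A : Assignment Pr Va Co) (G : Set (Atom Pr Va Co)) (r : Rule Pr Va Co) :
    Set (Atom Pr Va Co) × Set (Rule Pr Va Co) :=
  (A.pos, kUnassignedSet P kco kru r A)

/-- The default accumulator grounding strategy `ŝ_def`. -/
def defaultAccumStrategy (P : Finset (Rule Pr Va Co)) (A : Assignment Pr Va Co)
    (G : Set (Atom Pr Va Co)) (r : Rule Pr Va Co) :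
    Set (Atom Pr Va Co) × Set (Rule Pr Va Co) :=
  (G ∪ A.pos,
   { r' ∈ grd r | ¬ Inactive P r' ∧ OfInterest r' ((memAssign (G ∪ A.pos)).combine A) })

/-- The `k`-unassigned accumulator grounding strategy `ŝ_{k_co,k_ru}`. -/
def kUnassignedAccumStrategy (P : Finset (Rule Pr Va Co)) (kco kru : ℕ)
    (A : Assignment Pr Va Co) (G : Set (Atom Pr Va Co)) (r : Rule Pr Va Co) :
    Set (Atom Pr Va Co) × Set (Rule Pr Va Co) :=
  (G ∪ A.pos, kUnassignedSet P kco kru r ((memAssign (G ∪ A.pos)).combine A))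

/-! Semantics: models, FLP reduct, answer sets -/

/-- `I ⊨ r`: if the body holds then the head is nonempty and true. -/
def Satisfies (I : Set (Atom Pr Va Co)) (r : Rule Pr Va Co) : Prop :=
  (↑r.pos ⊆ I ∧ ↑r.neg ∩ I = ∅) → ∃ h, r.head = some h ∧ h ∈ I

def IsModel (I : Set (Atom Pr Va Co)) (Q : Set (Rule Pr Va Co)) : Prop :=
  ∀ r ∈ Q, Satisfies I r

/-- The FLP-reduct `Q^I`. -/
def Reduct (Q : Set (Rule Pr Va Co)) (I : Set (Atom Pr Va Co)) : Set (Rule Pr Va Co) :=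
  { r ∈ Q | ↑r.pos ⊆ I ∧ ↑r.neg ∩ I = ∅ }

/-- `I` is an answer set of `Q`: a subset-minimal model of the reduct `Q^I`. -/
def IsAnswerSet (I : Set (Atom Pr Va Co)) (Q : Set (Rule Pr Va Co)) : Prop :=
  IsModel I (Reduct Q I) ∧ ∀ J ⊆ I, IsModel J (Reduct Q I) → J = I

/-- Every atom of an answer set is the head of a rule of the program. -/
theorem IsAnswerSet.exists_head_eq {Pr Va Co : Type}
    {I : Set (Atom Pr Va Co)} {Q : Set (Rule Pr Va Co)} (hI : IsAnswerSet I Q)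
    {a : Atom Pr Va Co} (ha : a ∈ I) : ∃ r ∈ Q, r.head = some a := by
  have hJ : { b ∈ I | ∃ r ∈ Q, r.head = some b } = I := by
    refine hI.2 _ (fun _ hb => hb.1) fun r hr _ => ?_
    obtain ⟨h, hh, hmem⟩ := hI.1 r hr hr.2
    exact ⟨h, hh, hmem, r, hr.1, hh⟩
  rw [← hJ] at ha
  exact ha.2

theorem Term.subst_var {Va Co : Type} (t : Term Va Co) : t.subst Term.var = t := by
  cases t <;> rfl

theorem Atom.subst_var {Pr Va Co : Type} (a : Atom Pr Va Co) : a.subst Term.var = a := by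
  cases a
  simp [Atom.subst, funext Term.subst_var]

theorem Rule.subst_var {Pr Va Co : Type} [DecidableEq Pr] [DecidableEq Va] [DecidableEq Co]
    (r : Rule Pr Va Co) : r.subst Term.var = r := by
  have h : Atom.subst (Pr := Pr) (Co := Co) (Term.var (Va := Va)) = id :=
    funext Atom.subst_var
  cases r
  simp [Rule.subst, h]

/-- A safe rule with empty positive body is its own ground instance. -/
theorem Rule.Safe.mem_grd {Pr Va Co : Type} [DecidableEq Pr] [DecidableEq Va] [DecidableEq Co]
    {r : Rule Pr Va Co} (hr : r.Safe) (hpos : r.pos = ∅) : r ∈ grd r := by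
  refine ⟨Term.var, fun v hv => ?_, r.subst_var.symm⟩
  simpa [hpos, atomsVars] using hr hv

theorem exists_head_pred_eq_of_mem_grdP {Pr Va Co : Type}
    [DecidableEq Pr] [DecidableEq Va] [DecidableEq Co]
    {P : Finset (Rule Pr Va Co)} {r : Rule Pr Va Co} (hr : r ∈ grdP P)
    {a : Atom Pr Va Co} (ha : r.head = some a) :
    ∃ p ∈ P, ∃ h, p.head = some h ∧ h.pred = a.pred := by
  simp only [grdP, Set.mem_iUnion] at hr
  obtain ⟨p, hp, σ, -, rfl⟩ := hr
  obtain ⟨h, hh, rfl⟩ := Option.map_eq_some_iff.mp ha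
  exact ⟨p, hp, h, hh, rfl⟩

/-- No inactive rule survives in the reduct with respect to an answer set of a program lying
between the active ground rules and all ground rules. -/
theorem IsAnswerSet.not_inactive {Pr Va Co : Type}
    [DecidableEq Pr] [DecidableEq Va] [DecidableEq Co]
    {P : Finset (Rule Pr Va Co)} (hsafe : ∀ r ∈ P, r.Safe)
    {I : Set (Atom Pr Va Co)} {Q : Set (Rule Pr Va Co)} (hI : IsAnswerSet I Q)
    (hQ : Q ⊆ grdP P) (hactive : grdP P \ { r | Inactive P r } ⊆ Q)
    {r : Rule Pr Va Co} (hpos : ↑r.pos ⊆ I) (hneg : ↑r.neg ∩ I = ∅) : ¬ Inactive P r := by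
  rintro (⟨a, ha, hpred⟩ | ⟨a, ha, f, hf, hfpos, hfneg, hfhead⟩)
  · obtain ⟨s, hs, hhead⟩ := hI.exists_head_eq (hpos ha)
    obtain ⟨p, hp, h, hh, heq⟩ := exists_head_pred_eq_of_mem_grdP (hQ hs) hhead
    exact hpred p hp h hh heq
  · have hfQ : f ∈ Q := hactive
      ⟨Set.mem_biUnion hf ((hsafe f hf).mem_grd hfpos), by simp [Inactive, hfpos, hfneg]⟩
    have hbody : ↑f.pos ⊆ I ∧ ↑f.neg ∩ I = ∅ := by simp [hfpos, hfneg]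
    obtain ⟨h, hh, hmem⟩ := hI.1 f ⟨hfQ, hbody⟩ hbody
    obtain rfl : a = h := Option.some.inj (hfhead.symm.trans hh)
    exact Set.eq_empty_iff_forall_notMem.mp hneg a ⟨ha, hmem⟩

theorem IsAnswerSet.reduct_sdiff_inactive {Pr Va Co : Type}
    [DecidableEq Pr] [DecidableEq Va] [DecidableEq Co]
    {P : Finset (Rule Pr Va Co)} (hsafe : ∀ r ∈ P, r.Safe)
    {I : Set (Atom Pr Va Co)} {Q : Set (Rule Pr Va Co)} (hI : IsAnswerSet I Q)
    (hQ : Q ⊆ grdP P) (hactive : grdP P \ { r | Inactive P r } ⊆ Q) :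
    Reduct (grdP P \ { r | Inactive P r }) I = Reduct (grdP P) I :=
  Set.Subset.antisymm (fun _ hr => ⟨hr.1.1, hr.2⟩) fun _ hr =>
    ⟨⟨hr.1, hI.not_inactive hsafe hQ hactive hr.2.1 hr.2.2⟩, hr.2⟩

/-- Removing inactive rules preserves answer sets. -/
theorem answerSet_iff_without_inactive
    {Pr Va Co : Type} [DecidableEq Pr] [DecidableEq Va] [DecidableEq Co]
    (P : Finset (Rule Pr Va Co)) (hsafe : ∀ r ∈ P, r.Safe)
    (I : Set (Atom Pr Va Co)) :
    IsAnswerSet I (grdP P) ↔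
      IsAnswerSet I (grdP P \ { r | Inactive P r }) := by
  constructor <;> intro hI
  · have h := hI.reduct_sdiff_inactive hsafe subset_rfl Set.sdiff_subset
    rwa [IsAnswerSet, h]
  · have h := hI.reduct_sdiff_inactive hsafe Set.sdiff_subset subset_rfl
    rwa [IsAnswerSet, ← h]
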